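/- Let F be a full replete (normal epi)-reflective subcategory of a semi-abelian category A with protoadditive reflector F : A → F and associated radical T with counits t_K : T(K) → K. Then for every normal monomorphism k : K → A, the composite monomorphism k ∘ t_K : T(K) → A is a normal monomorphism. -/

import Mathlib

open CategoryTheory CategoryTheory.Limits

universe v u v₂ u₂

namespace ProtoPaper

variable {C : Type u} [Category.{v} C]

section ZeroDefs

variable [HasZeroMorphisms C]

/-- `k` is a kernel of `f`. -/
def IsKernelOf {K A B : C} (k : K ⟶ A) (f : A ⟶ B) : Prop :=
  ∃ w : k ≫ f = 0, Nonempty (IsLimit (KernelFork.ofι k w))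

/-- `f` is a cokernel of `k`. -/
def IsCokernelOf {K A B : C} (f : A ⟶ B) (k : K ⟶ A) : Prop :=
  ∃ w : k ≫ f = 0, Nonempty (IsColimit (CokernelCofork.ofπ f w))

/-- A normal monomorphism: a kernel of some morphism. -/
def IsNormalMonoArrow {K A : C} (k : K ⟶ A) : Prop :=
  ∃ (B : C) (f : A ⟶ B), IsKernelOf k f

/-- A normal epimorphism: a cokernel of some morphism. -/
def IsNormalEpiArrow {A B : C} (f : A ⟶ B) : Prop :=
  ∃ (K : C) (k : K ⟶ A), IsCokernelOf f k

/-- A split short exact sequence `0 → K → A ⇄ B → 0`. -/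
structure IsSplitShortExact {K A B : C} (k : K ⟶ A) (f : A ⟶ B) (s : B ⟶ A) : Prop where
  isKernel : IsKernelOf k f
  split : s ≫ f = 𝟙 B

/-- A short exact sequence `0 → K → A → B → 0`. -/
structure IsShortExact {K A B : C} (k : K ⟶ A) (f : A ⟶ B) : Prop where
  isKernel : IsKernelOf k f
  isCokernel : IsCokernelOf f k

/-- A protosplit monomorphism: a kernel of a split epimorphism. -/
def IsProtosplitMono {K A : C} (k : K ⟶ A) : Prop :=
  ∃ (B : C) (f : A ⟶ B) (s : B ⟶ A), IsSplitShortExact k f s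

end ZeroDefs

/-- A pointed category is protomodular when the split short five lemma holds. -/
def IsProtomodular (C : Type u) [Category.{v} C] [HasZeroMorphisms C] : Prop :=
  ∀ ⦃K A B K' A' B' : C⦄ (k : K ⟶ A) (f : A ⟶ B) (s : B ⟶ A)
    (k' : K' ⟶ A') (f' : A' ⟶ B') (s' : B' ⟶ A')
    (κ : K ⟶ K') (α : A ⟶ A') (β : B ⟶ B'),
    IsSplitShortExact k f s → IsSplitShortExact k' f' s' →
    k ≫ α = κ ≫ k' → f ≫ β = α ≫ f' → s ≫ α = β ≫ s' →
    IsIso κ → IsIso β → IsIso α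

section Functors

variable {D : Type u₂} [Category.{v₂} D]

/-- A functor is protoadditive if it preserves split short exact sequences. -/
def IsProtoadditive [HasZeroMorphisms C] [HasZeroMorphisms D] (F : C ⥤ D) : Prop :=
  ∀ ⦃K A B : C⦄ (k : K ⟶ A) (f : A ⟶ B) (s : B ⟶ A),
    IsSplitShortExact k f s → IsSplitShortExact (F.map k) (F.map f) (F.map s)

/-- A functor preserves zero objects. -/
def PreservesZeroObjects (F : C ⥤ D) : Prop :=
  ∀ X : C, IsZero X → IsZero (F.obj X)

/-- A functor preserves pullbacks along split epimorphisms. -/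
def PreservesPullbacksAlongSplitEpis (F : C ⥤ D) : Prop :=
  ∀ ⦃P X Y Z : C⦄ (fst : P ⟶ X) (snd : P ⟶ Y) (f : X ⟶ Z) (g : Y ⟶ Z),
    IsSplitEpi f → IsPullback fst snd f g →
    IsPullback (F.map fst) (F.map snd) (F.map f) (F.map g)

end Functors

/-- A homological category: pointed, protomodular and regular (finitely complete with
pullback-stable (regular epi, mono) factorisations). -/
structure IsHomological (C : Type u) [Category.{v} C] [HasZeroObject C]
    [HasZeroMorphisms C] : Prop where
  protomodular : IsProtomodular C
  hasFiniteLimits : HasFiniteLimits C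
  regEpiMonoFac : ∀ ⦃X Y : C⦄ (f : X ⟶ Y),
    ∃ (I : C) (e : X ⟶ I) (m : I ⟶ Y), Nonempty (RegularEpi e) ∧ Mono m ∧ e ≫ m = f
  regEpiStable : ∀ ⦃P X Y Z : C⦄ (fst : P ⟶ X) (snd : P ⟶ Y) (f : X ⟶ Z) (g : Y ⟶ Z),
    IsPullback fst snd f g → Nonempty (RegularEpi f) → Nonempty (RegularEpi snd)

/-- An internal equivalence relation, given by a jointly monic pair which is internally
reflexive, symmetric and transitive. -/
structure IsInternalEquivRel {R X : C} (p₁ p₂ : R ⟶ X) : Prop where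
  jointlyMono : ∀ ⦃Z : C⦄ (a b : Z ⟶ R), a ≫ p₁ = b ≫ p₁ → a ≫ p₂ = b ≫ p₂ → a = b
  refl : ∃ d : X ⟶ R, d ≫ p₁ = 𝟙 X ∧ d ≫ p₂ = 𝟙 X
  symm : ∃ σ : R ⟶ R, σ ≫ p₁ = p₂ ∧ σ ≫ p₂ = p₁
  trans : ∀ ⦃P : C⦄ (q₁ q₂ : P ⟶ R), IsPullback q₁ q₂ p₂ p₁ →
    ∃ t : P ⟶ R, t ≫ p₁ = q₁ ≫ p₁ ∧ t ≫ p₂ = q₂ ≫ p₂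

/-- A semi-abelian category: homological, with binary coproducts, and exact
(every internal equivalence relation is a kernel pair). -/
structure IsSemiAbelian (C : Type u) [Category.{v} C] [HasZeroObject C]
    [HasZeroMorphisms C] : Prop where
  homological : IsHomological C
  hasBinaryCoproducts : HasBinaryCoproducts C
  equivRelEffective : ∀ ⦃R X : C⦄ (p₁ p₂ : R ⟶ X), IsInternalEquivRel p₁ p₂ →
    ∃ (Y : C) (f : X ⟶ Y), IsPullback p₁ p₂ f f

/-- A full subcategory (given by a predicate on objects) is replete if it is closed
under isomorphisms. -/
def Replete (P : C → Prop) : Prop := ∀ ⦃X Y : C⦄, P X → (X ≅ Y) → P Y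

/-- A reflection of `C` onto the full subcategory of objects satisfying `P`:
a reflector `F`, a unit `η`, landing in `P`, with the usual universal property. -/
structure Reflection (C : Type u) [Category.{v} C] (P : C → Prop) where
  F : C ⥤ C
  η : 𝟭 C ⟶ F
  mem : ∀ X : C, P (F.obj X)
  univ : ∀ ⦃X B : C⦄, P B → ∀ f : X ⟶ B, ∃! g : F.obj X ⟶ B, η.app X ≫ g = f

variable {P : C → Prop}

/-- A (normal epi)-reflection: all units are normal epimorphisms. -/
def NormalEpiUnits [HasZeroMorphisms C] (R : Reflection C P) : Prop :=
  ∀ X : C, IsNormalEpiArrow (R.η.app X)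

/-- `f` is a trivial extension with respect to the reflection `R`. -/
def IsTrivialExt (R : Reflection C P) {A B : C} (f : A ⟶ B) : Prop :=
  IsPullback (R.η.app A) f (R.F.map f) (R.η.app B)

/-- `p` is an effective descent morphism: the pullback functor between the slice
categories is monadic. -/
def IsEffectiveDescent [HasPullbacks C] {E B : C} (p : E ⟶ B) : Prop :=
  Nonempty (MonadicRightAdjoint (Over.pullback p))

/-- A central extension with respect to the (absolute) Galois structure of a reflection:
some pullback along an effective descent morphism is a trivial extension. -/
def IsCentralExt [HasPullbacks C] (R : Reflection C P) {A B : C} (f : A ⟶ B) : Prop :=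
  ∃ (E : C) (p : E ⟶ B), IsEffectiveDescent p ∧
    ∃ (Pb : C) (p1 : Pb ⟶ E) (p2 : Pb ⟶ A), IsPullback p1 p2 p f ∧ IsTrivialExt R p1

/-- A normal extension with respect to the (absolute) Galois structure of a reflection. -/
def IsNormalExt [HasPullbacks C] (R : Reflection C P) {A B : C} (f : A ⟶ B) : Prop :=
  IsEffectiveDescent f ∧
    ∃ (Pb : C) (p1 p2 : Pb ⟶ A), IsPullback p1 p2 f f ∧ IsTrivialExt R p1

/-- A central extension with respect to the Galois structure of a reflection relative to
the class of normal epimorphisms. -/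
def IsCentralExtN [HasZeroMorphisms C] (R : Reflection C P) {A B : C} (f : A ⟶ B) : Prop :=
  IsNormalEpiArrow f ∧ ∃ (E : C) (p : E ⟶ B), IsNormalEpiArrow p ∧
    ∃ (Pb : C) (p1 : Pb ⟶ E) (p2 : Pb ⟶ A), IsPullback p1 p2 p f ∧ IsTrivialExt R p1

/-- A normal extension with respect to the Galois structure of a reflection relative to
the class of normal epimorphisms. -/
def IsNormalExtN [HasZeroMorphisms C] (R : Reflection C P) {A B : C} (f : A ⟶ B) : Prop :=
  IsNormalEpiArrow f ∧
    ∃ (Pb : C) (p1 p2 : Pb ⟶ A), IsPullback p1 p2 f f ∧ IsTrivialExt R p1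

/-- The reflector is semi-left-exact: it preserves pullbacks of units along morphisms
with domain in the subcategory. -/
def SemiLeftExact (R : Reflection C P) : Prop :=
  ∀ ⦃A X Pb : C⦄ (x : X ⟶ R.F.obj A) (p1 : Pb ⟶ A) (p2 : Pb ⟶ X), P X →
    IsPullback p1 p2 (R.η.app A) x →
    IsPullback (R.F.map p1) (R.F.map p2) (R.F.map (R.η.app A)) (R.F.map x)

/-- The reflector has stable units: it preserves pullbacks of units along arbitrary
morphisms. -/
def StableUnits (R : Reflection C P) : Prop :=
  ∀ ⦃A X Pb : C⦄ (x : X ⟶ R.F.obj A) (p1 : Pb ⟶ A) (p2 : Pb ⟶ X),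
    IsPullback p1 p2 (R.η.app A) x →
    IsPullback (R.F.map p1) (R.F.map p2) (R.F.map (R.η.app A)) (R.F.map x)

/-- The reflection is admissible with respect to the class of normal epimorphisms:
the reflector preserves pullbacks of units along normal epimorphisms with domain in
the subcategory. -/
def AdmissibleN [HasZeroMorphisms C] (R : Reflection C P) : Prop :=
  ∀ ⦃A X Pb : C⦄ (x : X ⟶ R.F.obj A) (p1 : Pb ⟶ A) (p2 : Pb ⟶ X), P X →
    IsNormalEpiArrow x →
    IsPullback p1 p2 (R.η.app A) x →
    IsPullback (R.F.map p1) (R.F.map p2) (R.F.map (R.η.app A)) (R.F.map x)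

/-- The radical associated to a (normal epi)-reflection is idempotent. -/
def IdempotentRadical [HasZeroMorphisms C] (R : Reflection C P) : Prop :=
  ∀ ⦃A TA : C⦄ (t : TA ⟶ A), IsKernelOf t (R.η.app A) →
    ∀ ⦃T2 : C⦄ (t2 : T2 ⟶ TA), IsKernelOf t2 (R.η.app TA) → IsIso t2

/-- Condition (N) for a (normal epi)-reflection: for any morphism `f` with kernel
`k : K ⟶ A`, and any kernel `t : TK ⟶ K` of the unit at `K`, the composite `t ≫ k`
is a normal monomorphism. -/
def ConditionN [HasZeroMorphisms C] (R : Reflection C P) : Prop :=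
  ∀ ⦃A B : C⦄ (f : A ⟶ B) ⦃K : C⦄ (k : K ⟶ A), IsKernelOf k f →
    ∀ ⦃TK : C⦄ (t : TK ⟶ K), IsKernelOf t (R.η.app K) → IsNormalMonoArrow (t ≫ k)

/-- A torsion theory on a pointed category, given by a pair of full replete
subcategories. -/
structure TorsionTheory (C : Type u) [Category.{v} C] [HasZeroMorphisms C]
    (T F : C → Prop) : Prop where
  repleteT : Replete T
  repleteF : Replete F
  hom_zero : ∀ ⦃X Y : C⦄ (f : X ⟶ Y), T X → F Y → f = 0
  exists_ses : ∀ A : C, ∃ (TA FA : C) (t : TA ⟶ A) (q : A ⟶ FA),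
    T TA ∧ F FA ∧ IsShortExact t q

/-- Condition (N) for a torsion theory, formulated without reference to a chosen
reflector: for any morphism `f` with kernel `k : K ⟶ A` and any short exact sequence
`0 → TK → K → FK → 0` with `TK` torsion and `FK` torsion-free, the composite
`TK → A` is a normal monomorphism. -/
def TTConditionN [HasZeroMorphisms C] (T F : C → Prop) : Prop :=
  ∀ ⦃A B K TK FK : C⦄ (f : A ⟶ B) (k : K ⟶ A) (t : TK ⟶ K) (q : K ⟶ FK),
    IsKernelOf k f → T TK → F FK → IsShortExact t q → IsNormalMonoArrow (t ≫ k)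

/-- Condition (P) for a torsion theory: the torsion-free reflector is protoadditive
(formulated for every (normal epi)-reflection onto the torsion-free part). -/
def TTConditionP [HasZeroMorphisms C] (T F : C → Prop) : Prop :=
  ∀ R : Reflection C F, NormalEpiUnits R → IsProtoadditive R.F

/-- Orthogonality `e ↓ m` of two morphisms. -/
def Orthogonal {A B X Y : C} (e : A ⟶ B) (m : X ⟶ Y) : Prop :=
  ∀ (a : A ⟶ X) (b : B ⟶ Y), e ≫ b = a ≫ m →
    ∃! d : B ⟶ X, e ≫ d = a ∧ d ≫ m = b

/-- The class of morphisms orthogonal on the right to all members of `E`. -/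
def dnOrth (E : MorphismProperty C) : MorphismProperty C :=
  fun _ _ m => ∀ ⦃A B : C⦄ (e : A ⟶ B), E e → Orthogonal e m

/-- The class of morphisms orthogonal on the left to all members of `M`. -/
def upOrth (M : MorphismProperty C) : MorphismProperty C :=
  fun _ _ e => ∀ ⦃X Y : C⦄ (m : X ⟶ Y), M m → Orthogonal e m

/-- A prefactorisation system. -/
structure IsPrefactorisationSystem (E M : MorphismProperty C) : Prop where
  E_eq : E = upOrth M
  M_eq : M = dnOrth E

/-- A factorisation system. -/
structure IsFactorisationSystem (E M : MorphismProperty C) : Prop where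
  E_eq : E = upOrth M
  M_eq : M = dnOrth E
  fac : ∀ ⦃X Y : C⦄ (f : X ⟶ Y),
    ∃ (I : C) (e : X ⟶ I) (m : I ⟶ Y), E e ∧ M m ∧ e ≫ m = f

/-- A pullback-stable class of morphisms. -/
def PullbackStable (E : MorphismProperty C) : Prop :=
  ∀ ⦃P X Y Z : C⦄ (fst : P ⟶ X) (snd : P ⟶ Y) (f : X ⟶ Z) (g : Y ⟶ Z),
    IsPullback fst snd f g → E f → E snd

/-- The class of morphisms inverted by the reflector. -/
def invertedByR (R : Reflection C P) : MorphismProperty C :=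
  fun _ _ f => IsIso (R.F.map f)

/-- The class of morphisms all of whose pullbacks lie in `E` ("stably in `E`"). -/
def StablyIn (E : MorphismProperty C) : MorphismProperty C :=
  fun _ Y e => ∀ ⦃Pb W : C⦄ (fst : Pb ⟶ W) (snd : Pb ⟶ _) (g : W ⟶ Y),
    IsPullback fst snd g e → E fst

/-- The class of morphisms locally in `M`: some pullback along an effective descent
morphism lies in `M`. -/
def locallyIn [HasPullbacks C] (M : MorphismProperty C) : MorphismProperty C :=
  fun _ B f => ∃ (E : C) (p : E ⟶ B), IsEffectiveDescent p ∧
    ∃ (Pb : C) (p1 : Pb ⟶ E) (p2 : Pb ⟶ _), IsPullback p1 p2 p f ∧ M p1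

/-- The class `Ē` associated to a torsion theory: normal epimorphisms with torsion
kernel. -/
def Ebar [HasZeroMorphisms C] (T : C → Prop) : MorphismProperty C :=
  fun X _ e => IsNormalEpiArrow e ∧ ∃ (K : C) (k : K ⟶ X), IsKernelOf k e ∧ T K

/-- The class `M̄` associated to a torsion theory: morphisms with torsion-free
kernel. -/
def Mbar [HasZeroMorphisms C] (F : C → Prop) : MorphismProperty C :=
  fun X _ m => ∃ (K : C) (k : K ⟶ X), IsKernelOf k m ∧ F K

/-- A Birkhoff subcategory: a (regular epi)-reflective subcategory such that the
naturality squares of the unit at regular epimorphisms are pushouts. -/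
structure IsBirkhoff [HasZeroMorphisms C] (R : Reflection C P) : Prop where
  units_regEpi : ∀ X : C, Nonempty (RegularEpi (R.η.app X))
  pushout_units : ∀ ⦃A B : C⦄ (f : A ⟶ B), Nonempty (RegularEpi f) →
    IsPushout f (R.η.app A) (R.η.app B) (R.F.map f)

section ArrowInstances

variable [HasZeroMorphisms C]

instance instZeroArrowHom (f g : Arrow C) : Zero (f ⟶ g) :=
  ⟨{ left := 0, right := 0, w := by simp }⟩

@[simp] lemma arrowHomZero_left (f g : Arrow C) : (0 : f ⟶ g).left = 0 := rfl

@[simp] lemma arrowHomZero_right (f g : Arrow C) : (0 : f ⟶ g).right = 0 := rfl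

instance instArrowHasZeroMorphisms : HasZeroMorphisms (Arrow C) where
  comp_zero {X Y} f Z := by
    apply CommaMorphism.ext <;> simp
  zero_comp X {Y Z} f := by
    apply CommaMorphism.ext <;> simp

end ArrowInstances

section Helpers

variable [HasZeroMorphisms C]

lemma IsKernelOf.comp_eq {K A B : C} {k : K ⟶ A} {f : A ⟶ B} (h : IsKernelOf k f) :
    k ≫ f = 0 := h.1

lemma IsKernelOf.exists_lift {K A B : C} {k : K ⟶ A} {f : A ⟶ B} (h : IsKernelOf k f)
    {Z : C} (x : Z ⟶ A) (hx : x ≫ f = 0) : ∃ y : Z ⟶ K, y ≫ k = x := by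
  obtain ⟨w, ⟨hl⟩⟩ := h
  exact ⟨_, (KernelFork.IsLimit.lift' hl x hx).2⟩

lemma IsKernelOf.mono {K A B : C} {k : K ⟶ A} {f : A ⟶ B} (h : IsKernelOf k f) : Mono k := by
  obtain ⟨w, ⟨hl⟩⟩ := h
  exact ⟨fun a b hab => Fork.IsLimit.hom_ext hl hab⟩

lemma IsKernelOf.mk' {K A B : C} {k : K ⟶ A} {f : A ⟶ B} (w : k ≫ f = 0) [Mono k]
    (hl : ∀ (Z : C) (x : Z ⟶ A), x ≫ f = 0 → ∃ y : Z ⟶ K, y ≫ k = x) : IsKernelOf k f := by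
  refine ⟨w, ⟨KernelFork.IsLimit.ofι k w (fun {Z} x hx => (hl Z x hx).choose)
    (fun {Z} x hx => (hl Z x hx).choose_spec) ?_⟩⟩
  intro Z x hx m hm
  rw [← cancel_mono k, hm, (hl Z x hx).choose_spec]

/-- The kernel of a pullback of a morphism. -/
lemma isKernelOf_pullback {Q X Y Z K : C} {p : Q ⟶ X} {q : Q ⟶ Y} {g : X ⟶ Z} {f : Y ⟶ Z}
    (h : IsPullback p q g f) {κ : K ⟶ Y} (hκ : IsKernelOf κ f) {κ' : K ⟶ Q}
    (h1 : κ' ≫ p = 0) (h2 : κ' ≫ q = κ) : IsKernelOf κ' p := by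
  have := hκ.mono
  have : Mono (κ' ≫ q) := by rw [h2]; infer_instance
  have : Mono κ' := mono_of_mono κ' q
  refine IsKernelOf.mk' h1 fun Z x hx => ?_
  obtain ⟨y, hy⟩ := hκ.exists_lift (x ≫ q) (by
    rw [Category.assoc, ← h.w, ← Category.assoc, hx, zero_comp])
  refine ⟨y, h.hom_ext ?_ ?_⟩
  · rw [Category.assoc, h1, hx, comp_zero]
  · rw [Category.assoc, h2, hy]

/-- A protoadditive functor sends the projections of a pullback along a split epimorphism
to a jointly monic pair. -/
lemma jointly_mono_map [HasPullbacks C] (hp : IsProtomodular C) {F : C ⥤ C}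
    (hF : IsProtoadditive F) {Q X Y Z K : C} {p : Q ⟶ X} {q : Q ⟶ Y} {g : X ⟶ Z} {f : Y ⟶ Z}
    (h : IsPullback p q g f) {κ : K ⟶ Y} {s : Z ⟶ Y} (hκ : IsSplitShortExact κ f s)
    {W : C} (a b : W ⟶ F.obj Q) (hap : a ≫ F.map p = b ≫ F.map p)
    (haq : a ≫ F.map q = b ≫ F.map q) : a = b := by
  have hw : (0 : K ⟶ X) ≫ g = κ ≫ f := by rw [hκ.isKernel.comp_eq, zero_comp]
  have hw2 : 𝟙 X ≫ g = (g ≫ s) ≫ f := by rw [Category.assoc, hκ.split]; simp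
  have hs1 : IsSplitShortExact (h.lift 0 κ hw) p (h.lift (𝟙 X) (g ≫ s) hw2) :=
    ⟨isKernelOf_pullback h hκ.isKernel (h.lift_fst _ _ _) (h.lift_snd _ _ _), h.lift_fst _ _ _⟩
  have hFs1 := hF _ _ _ hs1
  have hFκ := hF _ _ _ hκ
  have hPB := IsPullback.of_hasPullback (F.map g) (F.map f)
  have hw3 : (0 : F.obj K ⟶ F.obj X) ≫ F.map g = F.map κ ≫ F.map f := by
    rw [hFκ.isKernel.comp_eq, zero_comp]
  have hw4 : 𝟙 (F.obj X) ≫ F.map g = (F.map g ≫ F.map s) ≫ F.map f := by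
    rw [Category.assoc, hFκ.split]; simp
  have hs2 : IsSplitShortExact (hPB.lift 0 (F.map κ) hw3) (pullback.fst (F.map g) (F.map f))
      (hPB.lift (𝟙 _) (F.map g ≫ F.map s) hw4) :=
    ⟨isKernelOf_pullback hPB hFκ.isKernel (hPB.lift_fst _ _ _) (hPB.lift_snd _ _ _),
      hPB.lift_fst _ _ _⟩
  have hw5 : F.map p ≫ F.map g = F.map q ≫ F.map f := by
    rw [← F.map_comp, h.w, F.map_comp]
  have hiso : IsIso (hPB.lift (F.map p) (F.map q) hw5) := by
    refine hp _ _ _ _ _ _ (𝟙 _) _ (𝟙 _) hFs1 hs2 ?_ ?_ ?_ inferInstance inferInstance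
    · apply hPB.hom_ext
      · simp [hFs1.isKernel.comp_eq]
      · simp [← F.map_comp]
    · simp
    · apply hPB.hom_ext
      · rw [Category.assoc, hPB.lift_fst, ← F.map_comp, h.lift_fst, F.map_id, Category.assoc,
          hPB.lift_fst, Category.id_comp]
      · rw [Category.assoc, hPB.lift_snd, ← F.map_comp, h.lift_snd, F.map_comp, Category.assoc,
          hPB.lift_snd, Category.id_comp]
  rw [← cancel_mono (hPB.lift (F.map p) (F.map q) hw5)]
  apply hPB.hom_ext
  · simpa using hap
  · simpa using haq

end Helpers

/-- Lemma 2.8. Let `P` be a full replete (normal epi)-reflective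
subcategory of a semi-abelian category with protoadditive reflector `R`, and let the
radical be given by kernels of the units. Then for any normal monomorphism
`k : K ⟶ A` and any kernel `t : TK ⟶ K` of the unit at `K`, the composite
`t ≫ k : TK ⟶ A` is a normal monomorphism. -/
theorem statement5 {C : Type u} [Category.{v} C] [HasZeroObject C] [HasZeroMorphisms C]
    (hC : IsSemiAbelian C) {P : C → Prop} (hrepl : Replete P)
    (R : Reflection C P) (hne : NormalEpiUnits R) (hproto : IsProtoadditive R.F) :
    ∀ ⦃K A : C⦄ (k : K ⟶ A), IsNormalMonoArrow k →
      ∀ ⦃TK : C⦄ (t : TK ⟶ K), IsKernelOf t (R.η.app K) →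
        IsNormalMonoArrow (t ≫ k) := by
  intro K A k hk TK t ht
  obtain ⟨B, f, hkf⟩ := hk
  have := hC.homological.hasFiniteLimits
  have hp := hC.homological.protomodular
  obtain ⟨E, π₁, π₂, hE⟩ : ∃ (E : C) (π₁ π₂ : E ⟶ A), IsPullback π₁ π₂ f f :=
    ⟨_, _, _, IsPullback.of_hasPullback f f⟩
  obtain ⟨s, hs1, hs2⟩ := hE.exists_lift (𝟙 A) (𝟙 A) rfl
  obtain ⟨κ, hκ1, hκ2⟩ := hE.exists_lift (0 : K ⟶ A) k (by rw [hkf.comp_eq, zero_comp])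
  have hκ : IsSplitShortExact κ π₁ s := ⟨isKernelOf_pullback hE hkf hκ1 hκ2, hs1⟩
  have hκmono := hκ.isKernel.mono
  have hFκ := (hproto _ _ _ hκ).isKernel.mono
  have nat : ∀ {X Y : C} (g : X ⟶ Y), R.η.app X ≫ R.F.map g = g ≫ R.η.app Y := fun g =>
    (R.η.naturality g).symm
  have nat' : ∀ {Z X Y : C} (z : Z ⟶ X) (g : X ⟶ Y),
      (z ≫ R.η.app X) ≫ R.F.map g = (z ≫ g) ≫ R.η.app Y := fun z g => by
    rw [Category.assoc, nat, Category.assoc]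
  -- The relation on `A` : those `r` in `E` whose image in `F E` is degenerate.
  obtain ⟨S, ι, hι, hιm, hlift⟩ : ∃ (S : C) (ι : S ⟶ E),
      ι ≫ R.η.app E = (ι ≫ π₁ ≫ s) ≫ R.η.app E ∧ Mono ι ∧
      ∀ (Z : C) (x : Z ⟶ E), x ≫ R.η.app E = (x ≫ π₁ ≫ s) ≫ R.η.app E →
        ∃ y : Z ⟶ S, y ≫ ι = x := by
    let a : E ⟶ R.F.obj E := R.η.app E
    let b : E ⟶ R.F.obj E := (π₁ ≫ s) ≫ R.η.app E
    refine ⟨equalizer a b, equalizer.ι a b, ?_, inferInstance, fun Z x hx => ?_⟩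
    · have := equalizer.condition a b
      simpa [a, b] using this
    · exact ⟨equalizer.lift (f := a) (g := b) x (by simpa [a, b] using hx), equalizer.lift_ι _ _⟩
  have hι2 : (ι ≫ π₂) ≫ R.η.app A = (ι ≫ π₁) ≫ R.η.app A := by
    have := congrArg (fun z => z ≫ R.F.map π₂) hι
    simp only [nat'] at this
    simpa [hs2] using this
  have hdeg : ∀ {Z : C} (x y : Z ⟶ A), x ≫ R.η.app A = y ≫ R.η.app A →
      (x ≫ s) ≫ R.η.app E = (y ≫ s) ≫ R.η.app E := fun x y hxy => by
    rw [← nat', ← nat', hxy]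
  have hS : IsInternalEquivRel (ι ≫ π₁) (ι ≫ π₂) := by
    refine ⟨?_, ?_, ?_, ?_⟩
    · intro Z a b h1 h2
      rw [← cancel_mono ι]
      exact hE.hom_ext (by simpa using h1) (by simpa using h2)
    · obtain ⟨d, hd⟩ := hlift A s (by rw [reassoc_of% hs1])
      exact ⟨d, by rw [reassoc_of% hd, hs1], by rw [reassoc_of% hd, hs2]⟩
    · obtain ⟨σ, hσ1, hσ2⟩ := hE.exists_lift π₂ π₁ hE.w.symm
      have hsσ : s ≫ σ = s := hE.hom_ext (by rw [Category.assoc, hσ1, hs1, hs2])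
        (by rw [Category.assoc, hσ2, hs1, hs2])
      obtain ⟨y, hy⟩ := hlift S (ι ≫ σ) (by
        rw [← nat', hι, nat']
        have := hdeg _ _ hι2
        simp only [Category.assoc] at this
        simp only [Category.assoc, hsσ, reassoc_of% hσ1]
        exact this.symm)
      exact ⟨y, by rw [reassoc_of% hy, hσ1], by rw [reassoc_of% hy, hσ2]⟩
    · intro Q q₁ q₂ hQ
      obtain ⟨E2, p₁, p₂, hE2⟩ : ∃ (E2 : C) (p₁ p₂ : E2 ⟶ E), IsPullback p₁ p₂ π₂ π₁ :=
        ⟨_, _, _, IsPullback.of_hasPullback π₂ π₁⟩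
      obtain ⟨m, hm1, hm2⟩ := hE.exists_lift (p₁ ≫ π₁) (p₂ ≫ π₂) (by
        rw [Category.assoc, hE.w, reassoc_of% hE2.w, Category.assoc, ← hE.w])
      obtain ⟨c, hc1, hc2⟩ := hE2.exists_lift (q₁ ≫ ι) (q₂ ≫ ι) (by simpa using hQ.w)
      obtain ⟨d, hd1, hd2⟩ := hE2.exists_lift s s (by rw [hs1, hs2])
      have hdm : d ≫ m = s := hE.hom_ext
        (by rw [Category.assoc, hm1, reassoc_of% hd1, hs1])
        (by rw [Category.assoc, hm2, reassoc_of% hd2, hs2])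
      have e1 : (q₁ ≫ ι) ≫ R.η.app E = ((q₁ ≫ ι ≫ π₁) ≫ s) ≫ R.η.app E := by
        simpa using congrArg (fun z => q₁ ≫ z) hι
      have e2 : (q₂ ≫ ι) ≫ R.η.app E = ((q₁ ≫ ι ≫ π₁) ≫ s) ≫ R.η.app E := by
        have h1 : (q₂ ≫ ι) ≫ R.η.app E = ((q₂ ≫ ι ≫ π₁) ≫ s) ≫ R.η.app E := by
          simpa using congrArg (fun z => q₂ ≫ z) hι
        rw [h1, ← hQ.w]
        apply hdeg
        simpa using congrArg (fun z => q₁ ≫ z) hι2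
      have key : c ≫ R.η.app E2 = ((q₁ ≫ ι ≫ π₁) ≫ d) ≫ R.η.app E2 := by
        apply jointly_mono_map hp hproto hE2 hκ
        · rw [nat', nat', hc1, Category.assoc _ d, hd1, e1]
        · rw [nat', nat', hc2, Category.assoc _ d, hd2, e2]
      obtain ⟨y, hy⟩ := hlift Q (c ≫ m) (by
        rw [← nat', key, nat', Category.assoc _ d, hdm]
        simp only [Category.assoc, reassoc_of% hm1, reassoc_of% hc1])
      refine ⟨y, ?_, ?_⟩
      · rw [reassoc_of% hy, hm1, reassoc_of% hc1]
      · rw [reassoc_of% hy, hm2, reassoc_of% hc2]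
  obtain ⟨Y, g, hg⟩ := hC.equivRelEffective _ _ hS
  have := hkf.mono
  have := ht.mono
  refine ⟨Y, g, IsKernelOf.mk' ?_ ?_⟩
  · obtain ⟨y, hy⟩ := hlift TK (t ≫ κ) (by
      rw [Category.assoc, ← nat, reassoc_of% ht.comp_eq]
      simp [reassoc_of% hκ1])
    have h1 := congrArg (fun z => y ≫ z) hg.w
    simp only [Category.assoc, reassoc_of% hy, reassoc_of% hκ1, reassoc_of% hκ2] at h1
    simpa using h1.symm
  · intro Z x hx
    obtain ⟨l, hl1, hl2⟩ := hg.exists_lift (0 : Z ⟶ A) x (by rw [hx, zero_comp])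
    obtain ⟨y, hy⟩ := hκ.isKernel.exists_lift (l ≫ ι) (by simpa using hl1)
    obtain ⟨z, hz⟩ := ht.exists_lift y (by
      rw [← cancel_mono (R.F.map κ), nat', hy, zero_comp, Category.assoc, hι]
      have := congrArg (fun z => z ≫ s ≫ R.η.app E) hl1
      simpa using this)
    refine ⟨z, ?_⟩
    rw [reassoc_of% hz, ← hκ2, reassoc_of% hy, hl2]

end ProtoPaper
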